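/- arXiv:2405.04361 — 5 statements merged into one kernel-verified Lean document; each statement's English description precedes it below -/
import Mathlib

section
/- Let ℓ be a prime number, G a commutative group, S a subset of G with S = S⁻¹, and β : G → ℤ a function satisfying β(g⁻¹) = −β(g) for all g ∈ G. Suppose there exists h ∈ S whose order M := orderOf h satisfies M > 1 and gcd(M, ℓ) = 1, and such that ℓ does not divide β(h). Then there exist an integer k ≥ 1 and elements h₁, …, h_k of S such that the product h₁·h₂⋯h_k lies in S and β(h₁·h₂⋯h_k) ≢ β(h₁) + β(h₂) + ⋯ + β(h_k) (mod ℓ). -/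
/-- Let `ℓ` be a prime, `G` a commutative group, `S ⊆ G` with `S = S⁻¹`, and
`β : G → ℤ` with `β(g⁻¹) = −β(g)`.  If some `h ∈ S` has order `M > 1` coprime to `ℓ` and
`ℓ ∤ β(h)`, then there are `k ≥ 1` elements `h₁, …, h_k` of `S` whose product lies in `S` and
satisfies `β(h₁⋯h_k) ≢ β(h₁) + ⋯ + β(h_k) (mod ℓ)`. -/
theorem exists_tuple_beta_incongruent {G : Type*} [CommGroup G] (ℓ : ℕ) (hℓ : ℓ.Prime)
    (S : Set G) (hSinv : ∀ s : G, s ∈ S ↔ s⁻¹ ∈ S)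
    (β : G → ℤ) (hβ : ∀ g : G, β g⁻¹ = -β g)
    (h : G) (hhS : h ∈ S) (hM : 1 < orderOf h) (hcop : Nat.gcd (orderOf h) ℓ = 1)
    (hβh : ¬ ((ℓ : ℤ) ∣ β h)) :
    ∃ (k : ℕ) (f : Fin k → G), 1 ≤ k ∧ (∀ i, f i ∈ S) ∧ (∏ i, f i) ∈ S ∧
      ¬ ((ℓ : ℤ) ∣ (β (∏ i, f i) - ∑ i, β (f i))) := by
  have hprod : (∏ _i : Fin (orderOf h + 1), h) = h := by
    simp [pow_succ, pow_orderOf_eq_one]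
  refine ⟨orderOf h + 1, fun _ => h, by omega, fun _ => hhS, by rwa [hprod], ?_⟩
  have hdiff : β h - ∑ _i : Fin (orderOf h + 1), β h = -((orderOf h : ℤ) * β h) := by
    simp only [Finset.sum_const, Finset.card_univ, Fintype.card_fin, nsmul_eq_mul]
    push_cast
    ring
  rw [hprod, hdiff, dvd_neg, (Nat.prime_iff_prime_int.mp hℓ).dvd_mul, Int.natCast_dvd_natCast]
  rintro (hdvd | hdvd)
  · exact hℓ.one_lt.ne' (Nat.gcd_eq_right hdvd ▸ hcop)
  · exact hβh hdvd
end

section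
/- Let ℓ be an odd prime. With G, S, β, r, m as in the context, regard P₁(T) := r·(1+T)^m − Σ_{s ∈ S} (1+T)^{m−β(s)} as an element of the power series ring ℤ_ℓ⟦T⟧ over the ℓ-adic integers. Then there exists g ∈ ℤ_ℓ⟦T⟧ with P₁ = T²·g, and g is a unit of ℤ_ℓ⟦T⟧ if and only if ℓ does not divide Σ_{s ∈ S} β(s)² in ℤ. (Equivalently: the μ-invariant of P₁ is 0 and its λ-invariant is 2 if and only if Σ_{s ∈ S} β(s)² ≢ 0 mod ℓ.) -/
open Polynomial

theorem two_mul_choose_two_cast (n : ℕ) : 2 * (n.choose 2 : ℤ) = n * (n - 1) := by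
  induction n with
  | zero => simp
  | succ k ih =>
    rw [Nat.choose_succ_succ' k 1, Nat.choose_one_right]
    push_cast
    linarith

theorem Finset.sum_eq_zero_of_odd {G : Type*} [Group G] (S : Finset G)
    (hSinv : ∀ s : G, s ∈ S ↔ s⁻¹ ∈ S) (β : G → ℤ) (hβ : ∀ g : G, β g⁻¹ = -β g) :
    ∑ s ∈ S, β s = 0 := by
  have h : ∑ s ∈ S, β s = ∑ s ∈ S, -β s :=
    Finset.sum_nbij' (fun s => s⁻¹) (fun s => s⁻¹) (fun s hs => (hSinv s).1 hs)
      (fun s hs => (hSinv s).1 hs) (fun s _ => inv_inv s) (fun s _ => inv_inv s)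
      (fun s _ => by rw [hβ, neg_neg])
  rw [Finset.sum_neg_distrib] at h
  linarith

theorem PadicInt.isUnit_intCast_iff_not_dvd (p : ℕ) [Fact p.Prime] (k : ℤ) :
    IsUnit (k : ℤ_[p]) ↔ ¬ (p : ℤ) ∣ k := by
  rw [PadicInt.isUnit_iff, ← PadicInt.norm_int_lt_one_iff_dvd, not_lt]
  exact ⟨fun h => h.ge, fun h => le_antisymm (PadicInt.norm_le_one _) h⟩

/-- The coefficients of `r (1 + X) ^ a - ∑ (1 + X) ^ (b s)` are integers. -/
theorem Polynomial.coeff_card_mul_sub_sum {R ι : Type*} [CommRing R] (S : Finset ι) (a : ℕ)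
    (b : ι → ℕ) (n : ℕ) :
    ((S.card : R[X]) * (1 + X) ^ a - ∑ s ∈ S, (1 + X) ^ b s).coeff n =
      ((S.card * a.choose n - ∑ s ∈ S, ((b s).choose n : ℤ) : ℤ) : R) := by
  simp [Polynomial.coeff_one_add_X_pow, Polynomial.finsetSum_coeff]

/-- Let `ℓ` be an odd prime.  With `S = S⁻¹`, `1 ∉ S`, `β(g⁻¹) = −β(g)` and
`m = max_{s ∈ S} β(s)`, regard `P₁(T) = r·(1+T)^m − Σ_{s ∈ S} (1+T)^{m−β(s)}` as an element of
`ℤ_ℓ⟦T⟧`.  Then `P₁ = T²·g` for some `g ∈ ℤ_ℓ⟦T⟧`, and `g` is a unit if and only if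
`ℓ ∤ Σ_{s ∈ S} β(s)²`. -/
theorem trivial_character_poly_mu_lambda (ℓ : ℕ) [Fact ℓ.Prime] (hodd : ℓ ≠ 2)
    {G : Type*} [CommGroup G] [Fintype G] [DecidableEq G]
    (S : Finset G) (hS : S.Nonempty)
    (hSinv : ∀ s : G, s ∈ S ↔ s⁻¹ ∈ S) (hone : (1 : G) ∉ S)
    (β : G → ℤ) (hβ : ∀ g : G, β g⁻¹ = -β g) (m : ℤ) (hm : m = S.sup' hS β) :
    ∃ g : PowerSeries ℤ_[ℓ],
      (((S.card : Polynomial ℤ_[ℓ]) * (1 + X) ^ m.toNat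
          - ∑ s ∈ S, (1 + X) ^ (m - β s).toNat : Polynomial ℤ_[ℓ]) : PowerSeries ℤ_[ℓ])
        = PowerSeries.X ^ 2 * g ∧
      (IsUnit g ↔ ¬ ((ℓ : ℤ) ∣ ∑ s ∈ S, (β s) ^ 2)) := by
  have hle : ∀ s ∈ S, β s ≤ m := fun s hs => hm ▸ Finset.le_sup' β hs
  have hm0 : 0 ≤ m := by
    obtain ⟨s, hs⟩ := hS
    have h₁ := hle s hs
    have h₂ := hle s⁻¹ ((hSinv s).1 hs)
    rw [hβ] at h₂
    linarith
  have hsum := Finset.sum_eq_zero_of_odd S hSinv β hβ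
  have ha : (m.toNat : ℤ) = m := Int.toNat_of_nonneg hm0
  have hb : ∀ s ∈ S, ((m - β s).toNat : ℤ) = m - β s := fun s hs =>
    Int.toNat_of_nonneg (sub_nonneg.2 (hle s hs))
  have hcoeff := Polynomial.coeff_card_mul_sub_sum (R := ℤ_[ℓ]) S m.toNat
    (fun s => (m - β s).toNat)
  have htwo : 2 * (S.card * m.toNat.choose 2 - ∑ s ∈ S, ((m - β s).toNat.choose 2 : ℤ)) =
      -∑ s ∈ S, β s ^ 2 := by
    have h : ∀ s ∈ S, 2 * ((m - β s).toNat.choose 2 : ℤ) =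
        m * (m - 1) + (1 - 2 * m) * β s + β s ^ 2 := fun s hs => by
      rw [two_mul_choose_two_cast, hb s hs]
      ring
    rw [mul_sub, Finset.mul_sum, Finset.sum_congr rfl h, Finset.sum_add_distrib,
      Finset.sum_add_distrib, Finset.sum_const, nsmul_eq_mul, ← Finset.mul_sum, hsum,
      mul_left_comm, two_mul_choose_two_cast, ha]
    ring
  obtain ⟨g, hg⟩ : PowerSeries.X ^ 2 ∣
      (((S.card : Polynomial ℤ_[ℓ]) * (1 + X) ^ m.toNat
        - ∑ s ∈ S, (1 + X) ^ (m - β s).toNat : Polynomial ℤ_[ℓ]) : PowerSeries ℤ_[ℓ]) := by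
    rw [PowerSeries.X_pow_dvd_iff]
    intro n hn
    rw [Polynomial.coeff_coe, hcoeff]
    interval_cases n
    · simp
    · simp only [Nat.choose_one_right]
      rw [Finset.sum_congr rfl hb, Finset.sum_sub_distrib, hsum, ha]
      simp
  refine ⟨g, hg, ?_⟩
  have hg0 : PowerSeries.constantCoeff g =
      ((S.card * m.toNat.choose 2 - ∑ s ∈ S, ((m - β s).toNat.choose 2 : ℤ) : ℤ) : ℤ_[ℓ]) := by
    rw [← hcoeff 2, ← Polynomial.coeff_coe, hg, ← PowerSeries.coeff_zero_eq_constantCoeff_apply]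
    exact (PowerSeries.coeff_X_pow_mul g 2 0).symm
  have hℓ : Prime (ℓ : ℤ) := Nat.prime_iff_prime_int.1 Fact.out
  have hℓ2 : ¬ (ℓ : ℤ) ∣ 2 := fun h =>
    hodd ((Nat.prime_dvd_prime_iff_eq Fact.out Nat.prime_two).1 (by exact_mod_cast h))
  rw [PowerSeries.isUnit_iff_constantCoeff, hg0, PadicInt.isUnit_intCast_iff_not_dvd,
    ← dvd_neg (b := ∑ s ∈ S, β s ^ 2), ← htwo, hℓ.dvd_mul, or_iff_right hℓ2]
end

section
/- With G, S, β, r, m, P_ψ as in the context, let 𝒪 be a commutative local ring with maximal ideal 𝔪 and residue field k = 𝒪/𝔪. Suppose there exists s₀ ∈ S with β(s₀) ≠ 0 such that s₀ is the unique element of S with β-value β(s₀) (i.e., for all s ∈ S, β(s) = β(s₀) implies s = s₀). Then for every group homomorphism ψ : G → 𝒪ˣ, the image of P_ψ(T) under the coefficient-wise reduction map 𝒪[T] → k[T] is nonzero. (In particular the μ-invariant of P_ψ vanishes for every character ψ.) -/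
open Polynomial

/-- The polynomial `P_ψ(T) = r·(1+T)^m − Σ_{s ∈ S} ψ(s)·(1+T)^{m−β(s)}` attached to a
character `ψ : G → Rˣ`, where `r = |S|`. -/
noncomputable def Ppoly {G : Type*} [Group G] [DecidableEq G] (S : Finset G) (β : G → ℤ)
    (m : ℤ) {R : Type*} [CommRing R] (ψ : G →* Rˣ) : Polynomial R :=
  (S.card : Polynomial R) * (1 + X) ^ m.toNat
    - ∑ s ∈ S, C ((ψ s : Rˣ) : R) * (1 + X) ^ (m - β s).toNat

/-- Substituting `T = X - 1` into the reduction of `P_ψ` yields the polynomial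
`r·X^m − Σ_{s ∈ S} ψ(s)·X^{m−β(s)}`. -/
theorem Ppoly_map_comp_X_sub_one {G : Type*} [Group G] [DecidableEq G] (S : Finset G)
    (β : G → ℤ) (m : ℤ) {R k : Type*} [CommRing R] [CommRing k] (f : R →+* k) (ψ : G →* Rˣ) :
    ((Ppoly S β m ψ).map f).comp (X - 1) =
      C (S.card : k) * X ^ m.toNat - ∑ s ∈ S, C (f (ψ s : R)) * X ^ (m - β s).toNat := by
  simp [Ppoly, Polynomial.map_sum]

/-- Suppose some `s₀ ∈ S` with `β(s₀) ≠ 0` is the unique element of `S` with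
its `β`-value.  Then over any commutative local ring `𝒪`, for every character `ψ : G → 𝒪ˣ`
the coefficient-wise reduction of `P_ψ(T)` to the residue field is nonzero (so `μ_ψ = 0`). -/
theorem Ppoly_residue_ne_zero {G : Type*} [CommGroup G] [Fintype G] [DecidableEq G]
    (S : Finset G) (hS : S.Nonempty)
    (hSinv : ∀ s : G, s ∈ S ↔ s⁻¹ ∈ S) (hone : (1 : G) ∉ S)
    (β : G → ℤ) (hβ : ∀ g : G, β g⁻¹ = -β g) (m : ℤ) (hm : m = S.sup' hS β)
    (s₀ : G) (hs₀ : s₀ ∈ S) (hβs₀ : β s₀ ≠ 0) (huniq : ∀ s ∈ S, β s = β s₀ → s = s₀)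
    (𝒪 : Type*) [CommRing 𝒪] [IsLocalRing 𝒪] :
    ∀ ψ : G →* 𝒪ˣ, Polynomial.map (IsLocalRing.residue 𝒪) (Ppoly S β m ψ) ≠ 0 := by
  intro ψ hzero
  have hle : ∀ s ∈ S, β s ≤ m := fun s hs => hm ▸ Finset.le_sup' β hs
  have hle₀ := hle s₀ hs₀
  have hle_inv := hle s₀⁻¹ ((hSinv s₀).1 hs₀)
  rw [hβ] at hle_inv
  have hcomp := Ppoly_map_comp_X_sub_one S β m (IsLocalRing.residue 𝒪) ψ
  rw [hzero, zero_comp] at hcomp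
  have hcoeff := congrArg (fun p => p.coeff (m - β s₀).toNat) hcomp
  simp only [coeff_zero, coeff_sub, finsetSum_coeff, coeff_C_mul, coeff_X_pow] at hcoeff
  rw [if_neg (by omega), Finset.sum_eq_single_of_mem s₀ hs₀, if_pos rfl, mul_zero, mul_one,
    zero_sub, zero_eq_neg] at hcoeff
  · exact ((ψ s₀).isUnit.map (IsLocalRing.residue 𝒪)).ne_zero hcoeff
  · intro s hs hne
    have hβne : β s ≠ β s₀ := fun h => hne (huniq s hs h)
    have := hle s hs
    rw [if_neg (by omega), mul_zero]
end

section
/- Let n ≥ 2 be an integer, let G be a cyclic group of order n (e.g. G = Multiplicative (ZMod n)), let S := G \ {1} (so r = n − 1), and let β : G → ℤ satisfy β(g⁻¹) = −β(g) for all g, with m := max_{s ∈ S} β(s). Let 𝒪 be a commutative local ring that is an integral domain such that the image of n in 𝒪 is a unit, and let ψ : G → 𝒪ˣ be a nontrivial group homomorphism. Then the image in 𝒪⟦T⟧ of the polynomial P_ψ(T) := (n−1)·(1+T)^m − Σ_{s ∈ S} ψ(s)·(1+T)^{m−β(s)} is a unit of the power series ring 𝒪⟦T⟧. (Hence μ_ψ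 = λ_ψ = 0 for every nontrivial character of the complete graph K_n when ℓ ∤ n.) -/
open Polynomial

/-- Let `G` be cyclic of order `n ≥ 2` and `S := G \ {1}` (so the Cayley
graph is the complete graph `K_n`).  Over a commutative local integral domain `𝒪` in which
`n` is a unit, for every nontrivial character `ψ : G → 𝒪ˣ` the image of `P_ψ(T)` in `𝒪⟦T⟧`
is a unit (so `μ_ψ = λ_ψ = 0`). -/
theorem completeGraph_Ppoly_isUnit (n : ℕ) (hn : 2 ≤ n)
    {G : Type*} [Group G] [Fintype G] [IsCyclic G] [DecidableEq G]
    (hcard : Fintype.card G = n)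
    (hS : (Finset.univ.erase (1 : G)).Nonempty)
    (β : G → ℤ) (hβ : ∀ g : G, β g⁻¹ = -β g)
    (m : ℤ) (hm : m = (Finset.univ.erase (1 : G)).sup' hS β)
    (𝒪 : Type*) [CommRing 𝒪] [IsLocalRing 𝒪] [IsDomain 𝒪] (hunit : IsUnit (n : 𝒪))
    (ψ : G →* 𝒪ˣ) (hψ : ∃ g : G, ψ g ≠ 1) :
    IsUnit ((Ppoly (Finset.univ.erase (1 : G)) β m ψ : Polynomial 𝒪) : PowerSeries 𝒪) := by
  rw [PowerSeries.isUnit_iff_constantCoeff]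
  have hsum : ∑ g : G, ((ψ g : 𝒪ˣ) : 𝒪) = 0 := by
    refine sum_hom_units_eq_zero ((Units.coeHom 𝒪).comp ψ) fun h => ?_
    obtain ⟨g, hg⟩ := hψ
    exact hg (Units.ext (DFunLike.congr_fun h g))
  have herase : ∑ g ∈ Finset.univ.erase (1 : G), ((ψ g : 𝒪ˣ) : 𝒪) = -1 := by
    rw [← Finset.add_sum_erase _ _ (Finset.mem_univ (1 : G)), map_one, Units.val_one] at hsum
    exact eq_neg_of_add_eq_zero_right hsum
  have hconst : (Ppoly (Finset.univ.erase (1 : G)) β m ψ).coeff 0 = (n : 𝒪) := by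
    have hcard' : (Finset.univ.erase (1 : G)).card + 1 = n := by
      rw [Finset.card_erase_add_one (Finset.mem_univ _), Finset.card_univ, hcard]
    rw [coeff_zero_eq_eval_zero, Ppoly, ← hcard']
    simp only [eval_sub, eval_mul, eval_natCast, eval_pow, eval_add, eval_one, eval_X, add_zero,
      one_pow, mul_one, eval_finsetSum, eval_C, herase, sub_neg_eq_add, Nat.cast_add,
      Nat.cast_one]
  rwa [← PowerSeries.coeff_zero_eq_constantCoeff_apply, Polynomial.coeff_coe, hconst]
end

section
/- Let n ≥ 2 be an integer, ℓ a prime not dividing n, G a cyclic group of order n (e.g. G = Multiplicative (ZMod n)), S := G \ {1}, and β : G → ℤ a function with β(g⁻¹) = −β(g) for all g, m := max_{s ∈ S} β(s). Let 𝒪 be a commutative local integral domain containing a primitive n-th root of unity and in which the image of ℓ is not a unit. Assume ℓ does not divide Σ_{s ∈ S} β(s)² in ℤ. Then there exists a unit u of the power series ring 𝒪⟦T⟧ such that ∏_{ψ} P_ψ(T) = T²·u, where the product is over all group homomorphisms ψ : G → 𝒪ˣ. (This expresses that the Iwasawa invariants of the ℤ_ℓ-tower over the complete graph K_n satisfy μ_n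 = 0 and λ_n = 1.) -/
open Polynomial

theorem isUnit_intCast_of_not_dvd {R : Type*} [CommRing R] [IsLocalRing R] {p : ℕ}
    (hp : p.Prime) (hpR : ¬ IsUnit (p : R)) {a : ℤ} (ha : ¬ (p : ℤ) ∣ a) : IsUnit (a : R) := by
  obtain ⟨x, y, hxy⟩ := (Nat.prime_iff_prime_int.mp hp).irreducible.coprime_iff_not_dvd.mpr ha
  have h : (x : R) * p + y * a = 1 := by exact_mod_cast congrArg (Int.cast : ℤ → R) hxy
  rcases IsLocalRing.isUnit_or_isUnit_of_add_one h with h | h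
  · exact absurd (isUnit_of_mul_isUnit_right h) hpR
  · exact isUnit_of_mul_isUnit_right h

theorem two_mul_intCast_choose_two (k : ℕ) : 2 * (k.choose 2 : ℤ) = k * (k - 1) := by
  induction k with
  | zero => simp
  | succ k ih =>
    rw [Nat.choose_succ_succ' k 1]
    push_cast [Nat.choose_one_right]
    linarith

theorem sum_erase_one_eq_zero_of_odd {G : Type*} [Group G] [Fintype G] [DecidableEq G]
    {β : G → ℤ} (hβ : ∀ g : G, β g⁻¹ = -β g) : ∑ s ∈ Finset.univ.erase (1 : G), β s = 0 := by
  have h1 : β 1 = 0 := by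
    have := hβ 1
    rw [inv_one] at this
    omega
  rw [Finset.sum_erase _ h1]
  have h := Equiv.sum_comp (Equiv.inv G) β
  simp only [Equiv.inv_apply, hβ, Finset.sum_neg_distrib] at h
  omega

section Ppoly

variable {G : Type*} [Group G] [DecidableEq G] {R : Type*} [CommRing R]

theorem coeff_Ppoly (S : Finset G) (β : G → ℤ) (m : ℤ) (ψ : G →* Rˣ) (j : ℕ) :
    (Ppoly S β m ψ).coeff j
      = S.card * (m.toNat.choose j : R) - ∑ s ∈ S, (ψ s : R) * ((m - β s).toNat.choose j : R) := by
  rw [Ppoly, ← C_eq_natCast]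
  simp only [coeff_sub, coeff_C_mul, coeff_one_add_X_pow, finsetSum_coeff]

theorem coeff_Ppoly_one (S : Finset G) (β : G → ℤ) (m : ℤ) (j : ℕ) :
    (Ppoly S β m (1 : G →* Rˣ)).coeff j
      = ((∑ s ∈ S, ((m.toNat.choose j : ℤ) - ((m - β s).toNat.choose j : ℤ)) : ℤ) : R) := by
  simp [coeff_Ppoly]

theorem coeff_zero_Ppoly_of_ne_one [Fintype G] [IsDomain R] (β : G → ℤ) (m : ℤ)
    {ψ : G →* Rˣ} (hψ : ψ ≠ 1) :
    (Ppoly (Finset.univ.erase (1 : G)) β m ψ).coeff 0 = Fintype.card G := by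
  have hne : (Units.coeHom R).comp ψ ≠ 1 := fun h ↦ hψ <| by
    ext g
    exact DFunLike.congr_fun h g
  have hsum : ∑ g, (ψ g : R) = 0 := sum_hom_units_eq_zero _ hne
  rw [← Finset.add_sum_erase _ _ (Finset.mem_univ (1 : G))] at hsum
  have hS : ∑ s ∈ Finset.univ.erase (1 : G), (ψ s : R) = -1 := by
    rw [map_one, Units.val_one] at hsum
    linear_combination hsum
  have hcard : ((Finset.univ.erase (1 : G)).card : R) + 1 = Fintype.card G := by
    rw [← Finset.card_univ, ← Finset.card_erase_add_one (Finset.mem_univ (1 : G))]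
    push_cast
    rfl
  simp [coeff_Ppoly, hS, ← hcard, -Finset.card_erase_of_mem]

variable {S : Finset G} {β : G → ℤ} {m : ℤ}

theorem coeff_one_Ppoly_one (hm : 0 ≤ m) (hmβ : ∀ s ∈ S, β s ≤ m) (hsum : ∑ s ∈ S, β s = 0) :
    (Ppoly S β m (1 : G →* Rˣ)).coeff 1 = 0 := by
  rw [coeff_Ppoly_one, ← Int.cast_zero, ← hsum]
  congr 1
  refine Finset.sum_congr rfl fun s hs ↦ ?_
  have := hmβ s hs
  simp only [Nat.choose_one_right]
  omega

theorem exists_coeff_two_Ppoly_one (hm : 0 ≤ m) (hmβ : ∀ s ∈ S, β s ≤ m)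
    (hsum : ∑ s ∈ S, β s = 0) :
    ∃ a : ℤ, (Ppoly S β m (1 : G →* Rˣ)).coeff 2 = a ∧ 2 * a = -∑ s ∈ S, β s ^ 2 := by
  refine ⟨_, coeff_Ppoly_one S β m 2, ?_⟩
  have h : ∀ s ∈ S, 2 * ((m.toNat.choose 2 : ℤ) - ((m - β s).toNat.choose 2 : ℤ))
      = (2 * m - 1) * β s - β s ^ 2 := fun s hs ↦ by
    rw [mul_sub, two_mul_intCast_choose_two, two_mul_intCast_choose_two, Int.toNat_of_nonneg hm,
      Int.toNat_of_nonneg (sub_nonneg.mpr (hmβ s hs))]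
    ring
  rw [Finset.mul_sum, Finset.sum_congr rfl h, Finset.sum_sub_distrib, ← Finset.mul_sum, hsum]
  ring

end Ppoly

/-- Let `G` be cyclic of order `n ≥ 2`, `S := G \ {1}`, `ℓ` a prime not
dividing `n`, and `𝒪` a commutative local integral domain containing a primitive `n`-th root
of unity and in which `ℓ` is not a unit.  If `ℓ ∤ Σ_{s ∈ S} β(s)²`, then
`∏_ψ P_ψ(T) = T²·u` in `𝒪⟦T⟧` for some unit `u`, the product being over all characters
`ψ : G → 𝒪ˣ` (i.e. `μ_n = 0` and `λ_n = 1` for the complete graph `K_n`). -/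
theorem completeGraph_prod_Ppoly_eq_X_sq_mul_unit (n : ℕ) (hn : 2 ≤ n)
    (ℓ : ℕ) (hℓ : ℓ.Prime) (hℓn : ¬ (ℓ ∣ n))
    {G : Type*} [Group G] [Fintype G] [IsCyclic G] [DecidableEq G]
    (hcard : Fintype.card G = n)
    (hS : (Finset.univ.erase (1 : G)).Nonempty)
    (β : G → ℤ) (hβ : ∀ g : G, β g⁻¹ = -β g)
    (m : ℤ) (hm : m = (Finset.univ.erase (1 : G)).sup' hS β)
    (𝒪 : Type*) [CommRing 𝒪] [IsLocalRing 𝒪] [IsDomain 𝒪] [Fintype (G →* 𝒪ˣ)]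
    (hζ : ∃ ζ : 𝒪, IsPrimitiveRoot ζ n) (hℓ𝒪 : ¬ IsUnit (ℓ : 𝒪))
    (hβsq : ¬ ((ℓ : ℤ) ∣ ∑ s ∈ Finset.univ.erase (1 : G), (β s) ^ 2)) :
    ∃ u : (PowerSeries 𝒪)ˣ,
      (∏ ψ : G →* 𝒪ˣ,
          ((Ppoly (Finset.univ.erase (1 : G)) β m ψ : Polynomial 𝒪) : PowerSeries 𝒪))
        = PowerSeries.X ^ 2 * (u : PowerSeries 𝒪) := by
  classical
  set S := Finset.univ.erase (1 : G) with hSdef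
  have hmβ : ∀ s ∈ S, β s ≤ m := fun s hs ↦ hm ▸ Finset.le_sup' β hs
  have hm0 : 0 ≤ m := by
    obtain ⟨s, hs⟩ := hS
    have h := hmβ s hs
    have h' := hmβ s⁻¹ (by simpa [hSdef] using hs)
    rw [hβ] at h'
    omega
  have hsum : ∑ s ∈ S, β s = 0 := sum_erase_one_eq_zero_of_odd hβ
  have hn_unit : IsUnit (n : 𝒪) := by
    have := isUnit_intCast_of_not_dvd hℓ hℓ𝒪 (a := n) (by exact_mod_cast hℓn)
    exact_mod_cast this
  have hne : IsUnit (∏ ψ ∈ Finset.univ.erase (1 : G →* 𝒪ˣ),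
      ((Ppoly S β m ψ : Polynomial 𝒪) : PowerSeries 𝒪)) := by
    refine IsUnit.prod_iff.mpr fun ψ hψ ↦ ?_
    rw [PowerSeries.isUnit_iff_constantCoeff, ← PowerSeries.coeff_zero_eq_constantCoeff_apply,
      Polynomial.coeff_coe, coeff_zero_Ppoly_of_ne_one β m (Finset.ne_of_mem_erase hψ), hcard]
    exact hn_unit
  obtain ⟨a, ha, h2a⟩ := exists_coeff_two_Ppoly_one (R := 𝒪) hm0 hmβ hsum
  have ha_unit : IsUnit (a : 𝒪) := isUnit_intCast_of_not_dvd hℓ hℓ𝒪 fun h ↦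
    hβsq <| (dvd_neg).mp <| h2a ▸ h.mul_left 2
  obtain ⟨q, hq⟩ : PowerSeries.X ^ 2 ∣
      ((Ppoly S β m (1 : G →* 𝒪ˣ) : Polynomial 𝒪) : PowerSeries 𝒪) := by
    refine PowerSeries.X_pow_dvd_iff.mpr fun j hj ↦ ?_
    rw [Polynomial.coeff_coe]
    interval_cases j
    · simp [coeff_Ppoly_one]
    · exact coeff_one_Ppoly_one hm0 hmβ hsum
  have hq_unit : IsUnit q := by
    have h := congrArg (PowerSeries.coeff 2) hq
    rw [Polynomial.coeff_coe, ha, PowerSeries.coeff_X_pow_mul', if_pos le_rfl, Nat.sub_self,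
      PowerSeries.coeff_zero_eq_constantCoeff_apply] at h
    exact PowerSeries.isUnit_iff_constantCoeff.mpr (h ▸ ha_unit)
  refine ⟨(hq_unit.mul hne).unit, ?_⟩
  rw [← Finset.mul_prod_erase _ _ (Finset.mem_univ (1 : G →* 𝒪ˣ)), hq, mul_assoc, IsUnit.unit_spec]
end
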